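/- arXiv:2407.18301 — 5 statements merged into one kernel-verified Lean document; each statement's English description precedes it below -/
import Mathlib

section
/- Let s ∈ ℝ satisfy s ≠ d_k for every k, and suppose Σ_{k=0}^{N−1} |v_k|²/(s − d_k) ≠ 0. Define μ(s) := (Σ_{k=0}^{N−1} |v_k|²/(s − d_k))^{-1}. Then s is an eigenvalue of the Hermitian matrix D + μ(s) v v†. -/
open Matrix BigOperators

/-- Inner product on `ι → ℂ`, conjugate-linear in the first argument. -/
noncomputable def dotc {ι : Type*} [Fintype ι] (x y : ι → ℂ) : ℂ :=
  ∑ i, (starRingEnd ℂ) (x i) * y i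

/-- Euclidean norm on `ι → ℂ`. -/
noncomputable def cnorm {ι : Type*} [Fintype ι] (x : ι → ℂ) : ℝ :=
  Real.sqrt (∑ i, Complex.normSq (x i))

/-- The rank-one perturbed Hamiltonian `H(μ) = D + μ v v†`. -/
noncomputable def Hmu {N : ℕ} (D : Matrix (Fin N) (Fin N) ℂ) (v : Fin N → ℂ) (μ : ℝ) :
    Matrix (Fin N) (Fin N) ℂ :=
  D + (μ : ℂ) • Matrix.vecMulVec v (star v)

/-- A vector is the sum of its components in an orthonormal family of full cardinality. -/
theorem sum_dotc_smul_of_orthonormal {ι : Type*} [Fintype ι] [DecidableEq ι] {e : ι → ι → ℂ}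
    (he : ∀ k l, dotc (e k) (e l) = if k = l then 1 else 0) (v : ι → ℂ) :
    ∑ k, dotc (e k) v • e k = v := by
  let E : Matrix ι ι ℂ := Matrix.of fun i k => e k i
  have hleft : Eᴴ * E = 1 := by
    ext k l
    simpa [E, Matrix.mul_apply, Matrix.one_apply, dotc] using he k l
  have hright : E * Eᴴ = 1 := mul_eq_one_comm.mp hleft
  have hcomp : Eᴴ *ᵥ v = fun k => dotc (e k) v := by
    ext k
    simp [E, Matrix.mulVec, dotProduct, dotc]
  calc ∑ k, dotc (e k) v • e k = E *ᵥ (Eᴴ *ᵥ v) := by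
        rw [hcomp]
        ext i
        simp [E, Matrix.mulVec, dotProduct, mul_comm]
    _ = v := by rw [Matrix.mulVec_mulVec, hright, Matrix.one_mulVec]

theorem star_dotProduct_eq_dotc {ι : Type*} [Fintype ι] (x y : ι → ℂ) :
    star x ⬝ᵥ y = dotc x y := rfl

theorem dotc_mul_dotc_swap {ι : Type*} [Fintype ι] (x y : ι → ℂ) :
    dotc x y * dotc y x = (Complex.normSq (dotc x y) : ℂ) := by
  have h : dotc y x = (starRingEnd ℂ) (dotc x y) := by
    simp [dotc, mul_comm]
  rw [h, Complex.mul_conj]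

theorem Hmu_mulVec {N : ℕ} (D : Matrix (Fin N) (Fin N) ℂ) (v w : Fin N → ℂ) (μ : ℝ) :
    Hmu D v μ *ᵥ w = D *ᵥ w + ((μ : ℂ) * dotc v w) • v := by
  rw [Hmu, Matrix.add_mulVec, Matrix.smul_mulVec, Matrix.vecMulVec_mulVec,
    star_dotProduct_eq_dotc, op_smul_eq_smul, smul_smul]

theorem stmt1
    (N : ℕ) (hN : 2 ≤ N)
    (D : Matrix (Fin N) (Fin N) ℂ) (hD : D.IsHermitian)
    (d : Fin N → ℝ) (hd : StrictMono d)
    (e : Fin N → (Fin N → ℂ))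
    (he : ∀ k l, dotc (e k) (e l) = if k = l then 1 else 0)
    (heig : ∀ k, D.mulVec (e k) = (d k : ℂ) • e k)
    (v : Fin N → ℂ)
    (s : ℝ) (hs : ∀ k, s ≠ d k)
    (hsum : (∑ k, Complex.normSq (dotc (e k) v) / (s - d k)) ≠ 0) :
    ∃ w : Fin N → ℂ, w ≠ 0 ∧
      (Hmu D v ((∑ k, Complex.normSq (dotc (e k) v) / (s - d k))⁻¹)).mulVec w
        = (s : ℂ) • w := by
  set S : ℝ := ∑ k, Complex.normSq (dotc (e k) v) / (s - d k) with hS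
  have hne : ∀ k, (s : ℂ) - d k ≠ 0 := fun k => by
    exact_mod_cast sub_ne_zero.mpr (hs k)
  let w : Fin N → ℂ := ∑ k, (dotc (e k) v / ((s : ℂ) - d k)) • e k
  have hvw : dotc v w = S := by
    rw [← star_dotProduct_eq_dotc, dotProduct_sum, hS, Complex.ofReal_sum]
    refine Finset.sum_congr rfl fun k _ => ?_
    rw [dotProduct_smul, star_dotProduct_eq_dotc, smul_eq_mul, div_mul_eq_mul_div,
      dotc_mul_dotc_swap]
    push_cast
    rfl
  have hDw : D *ᵥ w + v = (s : ℂ) • w := by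
    conv_lhs => rw [← sum_dotc_smul_of_orthonormal he v]
    rw [Matrix.mulVec_sum, Finset.smul_sum, ← Finset.sum_add_distrib]
    refine Finset.sum_congr rfl fun k _ => ?_
    rw [Matrix.mulVec_smul, heig, smul_smul, smul_smul,
      ← add_smul]
    congr 1
    field_simp [hne k]
    ring
  refine ⟨w, fun hw => hsum ?_, ?_⟩
  · have h0 : (S : ℂ) = 0 := by rw [← hvw, hw]; simp [dotc]
    exact_mod_cast h0
  · have hμ : ((S⁻¹ : ℝ) : ℂ) * dotc v w = 1 := by
      rw [hvw, ← Complex.ofReal_mul, inv_mul_cancel₀ hsum, Complex.ofReal_one]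
    rw [Hmu_mulVec, hμ, one_smul, hDw]
end

section
/- Minimum-gap theorem for the edge case: for every index k ≤ N−2 there exists a constant C₀ > 0, depending only on the eigenvalues d_0, …, d_{N−1} of D (and independent of μ and ε), such that for every ε > 0 with (N−1)ε² < 1/2 and every μ > 0, the consecutive eigenvalues of H(μ) built from the edge-case vector v(ε) satisfy s_{k+1}(μ) − s_k(μ) > C₀ ε². -/
open Matrix BigOperators

/-- The edge-case vector `v(ε)`: component `1 − (N−1)ε²` along `e i`, and `ε` along
every other eigenvector of `D`. -/
noncomputable def edgeVec {N : ℕ} (e : Fin N → (Fin N → ℂ)) (i : Fin N) (ε : ℝ) :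
    Fin N → ℂ :=
  fun x => ∑ j, (if j = i then (((1 : ℝ) - ((N : ℝ) - 1) * ε ^ 2 : ℝ) : ℂ) else (ε : ℂ)) * e j x

lemma dotc_eq_dotProduct {ι : Type*} [Fintype ι] (x y : ι → ℂ) : dotc x y = star x ⬝ᵥ y := rfl

/-- Parseval's identity for an orthonormal family indexed by the coordinate type. -/
lemma sum_conj_dotc_mul_dotc {ι : Type*} [Fintype ι] [DecidableEq ι] {e : ι → ι → ℂ}
    (he : ∀ k l, dotc (e k) (e l) = if k = l then 1 else 0) (x y : ι → ℂ) :
    ∑ j, (starRingEnd ℂ) (dotc (e j) x) * dotc (e j) y = dotc x y := by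
  let E : Matrix ι ι ℂ := Matrix.of fun j => star (e j)
  have hE : E * Eᴴ = 1 := by
    ext k l
    have h : (E * Eᴴ) k l = dotc (e k) (e l) := by
      simp [E, Matrix.mul_apply, dotc]
    rw [h, he, Matrix.one_apply]
  have hE' : Eᴴ * E = 1 := mul_eq_one_comm.mp hE
  calc ∑ j, (starRingEnd ℂ) (dotc (e j) x) * dotc (e j) y
      = star (E *ᵥ x) ⬝ᵥ (E *ᵥ y) := rfl
    _ = dotc x y := by
      rw [Matrix.star_mulVec, ← Matrix.dotProduct_mulVec, Matrix.mulVec_mulVec, hE',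
        Matrix.one_mulVec, dotc_eq_dotProduct]

lemma dotc_mulVec_of_isHermitian {ι : Type*} [Fintype ι] {D : Matrix ι ι ℂ}
    (hD : D.IsHermitian) {f : ι → ℂ} {r : ℝ} (hf : D *ᵥ f = (r : ℂ) • f) (w : ι → ℂ) :
    dotc f (D *ᵥ w) = r * dotc f w := by
  rw [dotc_eq_dotProduct, dotc_eq_dotProduct, Matrix.dotProduct_mulVec]
  nth_rewrite 1 [← hD.eq]
  rw [← Matrix.star_mulVec, hf, star_smul, smul_dotProduct]
  simp

/-- The components of an eigenvector of `H(μ)` in the eigenbasis of `D`. -/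
lemma sub_mul_dotc_of_Hmu_mulVec {N : ℕ} {D : Matrix (Fin N) (Fin N) ℂ}
    (hD : D.IsHermitian) {f : Fin N → ℂ} {r : ℝ} (hf : D *ᵥ f = (r : ℂ) • f)
    {v w : Fin N → ℂ} {μ t : ℝ} (hw : Hmu D v μ *ᵥ w = (t : ℂ) • w) :
    ((t : ℂ) - r) * dotc f w = μ * dotc v w * dotc f v := by
  have h := congrArg (dotc f) hw
  rw [Hmu, Matrix.add_mulVec, Matrix.smul_mulVec, Matrix.vecMulVec_mulVec] at h
  have h1 := dotc_mulVec_of_isHermitian hD hf w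
  simp only [dotc_eq_dotProduct, dotProduct_add, dotProduct_smul, smul_eq_mul,
    MulOpposite.smul_eq_mul_unop, MulOpposite.unop_op] at h h1 ⊢
  rw [h1] at h
  linear_combination -h

lemma dotc_edgeVec {N : ℕ} {e : Fin N → (Fin N → ℂ)}
    (he : ∀ k l, dotc (e k) (e l) = if k = l then 1 else 0) (i j : Fin N) (ε : ℝ) :
    dotc (e j) (edgeVec e i ε) =
      ((if j = i then 1 - ((N : ℝ) - 1) * ε ^ 2 else ε : ℝ) : ℂ) := by
  have h : edgeVec e i ε =
      ∑ l, (if l = i then (((1 : ℝ) - ((N : ℝ) - 1) * ε ^ 2 : ℝ) : ℂ) else (ε : ℂ)) • e l := by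
    ext x
    simp only [edgeVec, Finset.sum_apply, Pi.smul_apply, smul_eq_mul]
  rw [h, dotc_eq_dotProduct, dotProduct_sum]
  simp only [dotProduct_smul, ← dotc_eq_dotProduct, he, smul_eq_mul]
  simp only [mul_ite, mul_one, mul_zero, Finset.sum_ite_eq, Finset.mem_univ, if_true]
  split_ifs <;> rfl

/-- If every component of `v` is nonzero, an eigenvector of `H(μ)` is not orthogonal to `v`. -/
lemma dotc_ne_zero_of_Hmu_mulVec {N : ℕ} {D : Matrix (Fin N) (Fin N) ℂ}
    (hD : D.IsHermitian) {d : Fin N → ℝ} (hd : Function.Injective d)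
    {e : Fin N → (Fin N → ℂ)} (he : ∀ k l, dotc (e k) (e l) = if k = l then 1 else 0)
    (heig : ∀ k, D *ᵥ e k = (d k : ℂ) • e k) {v w : Fin N → ℂ} {μ t : ℝ}
    (hv : ∀ j, dotc (e j) v ≠ 0) (hw1 : dotc w w = 1)
    (hw : Hmu D v μ *ᵥ w = (t : ℂ) • w) : dotc v w ≠ 0 := by
  intro h0
  have hc : ∀ j, ((t : ℂ) - d j) * dotc (e j) w = 0 := fun j => by
    rw [sub_mul_dotc_of_Hmu_mulVec hD (heig j) hw, h0]; ring
  obtain ⟨j, hj⟩ : ∃ j, dotc (e j) w ≠ 0 := by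
    by_contra! hall
    have h := sum_conj_dotc_mul_dotc he w w
    simp [hall, hw1] at h
  have ht : t = d j := by
    have := (mul_eq_zero.mp (hc j)).resolve_right hj
    exact_mod_cast sub_eq_zero.mp this
  have hother : ∀ l, l ≠ j → dotc (e l) w = 0 := fun l hl => by
    refine (mul_eq_zero.mp (hc l)).resolve_left fun h => hl (hd ?_)
    rw [← ht]
    exact_mod_cast (sub_eq_zero.mp h).symm
  have h := sum_conj_dotc_mul_dotc he v w
  rw [Finset.sum_eq_single j (fun l _ hl => by rw [hother l hl, mul_zero]) (by simp), h0] at h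
  exact mul_ne_zero (by simpa using hv j) hj h

/-- Orthogonality of two eigenvectors of `H(μ)`, expressed through their eigenvalues. -/
lemma sum_sq_div_eq_zero {N : ℕ} {D : Matrix (Fin N) (Fin N) ℂ}
    (hD : D.IsHermitian) {d : Fin N → ℝ} (hd : Function.Injective d)
    {e : Fin N → (Fin N → ℂ)} (he : ∀ k l, dotc (e k) (e l) = if k = l then 1 else 0)
    (heig : ∀ k, D *ᵥ e k = (d k : ℂ) • e k) {v w w' : Fin N → ℂ} {μ x y : ℝ} (hμ : μ ≠ 0)
    {a : Fin N → ℝ} (ha : ∀ j, dotc (e j) v = (a j : ℂ)) (ha0 : ∀ j, a j ≠ 0)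
    (hw1 : dotc w w = 1) (hw1' : dotc w' w' = 1) (horth : dotc w w' = 0)
    (hw : Hmu D v μ *ᵥ w = (x : ℂ) • w) (hw' : Hmu D v μ *ᵥ w' = (y : ℂ) • w') :
    (∀ j, x ≠ d j) ∧ (∀ j, y ≠ d j) ∧ ∑ j, a j ^ 2 / ((x - d j) * (y - d j)) = 0 := by
  have hv : ∀ j, dotc (e j) v ≠ 0 := fun j => by
    rw [ha]; exact_mod_cast ha0 j
  have hμ' : (μ : ℂ) ≠ 0 := by exact_mod_cast hμ
  have key : ∀ (u : Fin N → ℂ) (t : ℝ), dotc u u = 1 → Hmu D v μ *ᵥ u = (t : ℂ) • u →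
      dotc v u ≠ 0 ∧ (∀ j, t ≠ d j) ∧
        ∀ j, dotc (e j) u = μ * dotc v u * (a j / (t - d j)) := by
    intro u t hu1 hu
    have hα := dotc_ne_zero_of_Hmu_mulVec hD hd he heig hv hu1 hu
    have hcomp := fun j => sub_mul_dotc_of_Hmu_mulVec hD (heig j) hu
    have hne : ∀ j, t ≠ d j := fun j h => by
      have := hcomp j
      rw [h, sub_self, zero_mul] at this
      exact mul_ne_zero (mul_ne_zero hμ' hα) (hv j) this.symm
    refine ⟨hα, hne, fun j => ?_⟩
    have h0 : (t : ℂ) - d j ≠ 0 := sub_ne_zero.mpr (by exact_mod_cast hne j)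
    have := hcomp j
    rw [ha] at this
    field_simp
    linear_combination this
  obtain ⟨hα, hx, hcw⟩ := key w x hw1 hw
  obtain ⟨hβ, hy, hcw'⟩ := key w' y hw1' hw'
  refine ⟨hx, hy, ?_⟩
  have h := sum_conj_dotc_mul_dotc he w w'
  rw [horth] at h
  have hfac : ∑ j, (starRingEnd ℂ) (dotc (e j) w) * dotc (e j) w' =
      (μ * μ * (starRingEnd ℂ) (dotc v w) * dotc v w') *
        ((∑ j, a j ^ 2 / ((x - d j) * (y - d j)) : ℝ) : ℂ) := by
    push_cast
    rw [Finset.mul_sum]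
    refine Finset.sum_congr rfl fun j _ => ?_
    rw [hcw, hcw', div_eq_mul_inv, div_eq_mul_inv, div_eq_mul_inv, mul_inv]
    simp only [map_mul, map_inv₀, map_sub, Complex.conj_ofReal]
    ring
  rw [hfac] at h
  have hne : (μ * μ * (starRingEnd ℂ) (dotc v w) * dotc v w' : ℂ) ≠ 0 :=
    mul_ne_zero (mul_ne_zero (mul_ne_zero hμ' hμ') (by simpa using hα)) hβ
  exact_mod_cast (mul_eq_zero.mp h).resolve_left hne

lemma exists_pos_le_abs_sub {ι : Type*} [Finite ι] {d : ι → ℝ} (hd : Function.Injective d) :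
    ∃ δ > 0, ∀ j l, j ≠ l → δ ≤ |d j - d l| := by
  classical
  cases nonempty_fintype ι
  rcases (Finset.univ : Finset ι).offDiag.eq_empty_or_nonempty with h | h
  · refine ⟨1, one_pos, fun j l hjl => ?_⟩
    have : (j, l) ∈ (Finset.univ : Finset ι).offDiag := by simp [hjl]
    simp [h] at this
  · obtain ⟨p, hp, hmin⟩ := Finset.exists_min_image _ (fun p : ι × ι => |d p.1 - d p.2|) h
    refine ⟨|d p.1 - d p.2|, abs_pos.mpr (sub_ne_zero.mpr fun h => ?_), fun j l hjl => ?_⟩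
    · exact (Finset.mem_offDiag.mp hp).2.2 (hd h)
    · exact hmin (j, l) (by simp [hjl])

/-- Two nearby zeros of the orthogonality relation with weights in `[q, 1]` and
`δ`-separated poles are at distance at least `δ * √(q / n)`. -/
lemma mul_sq_le_of_sum_div_eq_zero {ι : Type*} [Fintype ι] [Nonempty ι] {d p : ι → ℝ}
    {δ q x y : ℝ} (hδ : 0 < δ) (hsep : ∀ j l, j ≠ l → δ ≤ |d j - d l|) (hq : 0 < q)
    (hqp : ∀ j, q ≤ p j) (hp1 : ∀ j, p j ≤ 1) (hxy : x ≤ y) (hx : ∀ j, x ≠ d j)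
    (hy : ∀ j, y ≠ d j) (hsum : ∑ j, p j / ((x - d j) * (y - d j)) = 0)
    (hclose : y - x < δ / 2) : q * δ ^ 2 ≤ Fintype.card ι * (y - x) ^ 2 := by
  classical
  obtain ⟨m, hm⟩ : ∃ m, (x - d m) * (y - d m) < 0 := by
    by_contra! hall
    refine (Finset.sum_pos (fun j _ => div_pos (hq.trans_le (hqp j)) ?_)
      Finset.univ_nonempty).ne' hsum
    exact (hall j).lt_of_ne' (mul_ne_zero (sub_ne_zero.mpr (hx j)) (sub_ne_zero.mpr (hy j)))
  have hxm : x < d m := by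
    by_contra! h
    nlinarith [mul_nonneg (sub_nonneg.mpr h) (sub_nonneg.mpr (h.trans hxy))]
  have hym : d m < y := by
    by_contra! h
    nlinarith [mul_nonneg (sub_nonneg.mpr hxm.le) (sub_nonneg.mpr h)]
  have hfar : ∀ j ∈ Finset.univ.erase m, p j / ((x - d j) * (y - d j)) ≤ 4 / δ ^ 2 := by
    intro j hj
    have hprod : δ ^ 2 / 4 ≤ (x - d j) * (y - d j) := by
      rcases le_abs.mp (hsep j m (Finset.ne_of_mem_erase hj)) with h | h
      · nlinarith [mul_nonneg (show 0 ≤ d j - x - δ / 2 by linarith)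
          (show 0 ≤ d j - y - δ / 2 by linarith)]
      · nlinarith [mul_nonneg (show 0 ≤ x - d j - δ / 2 by linarith)
          (show 0 ≤ y - d j - δ / 2 by linarith)]
    calc p j / ((x - d j) * (y - d j)) ≤ 1 / (δ ^ 2 / 4) :=
          div_le_div₀ zero_le_one (hp1 j) (by positivity) hprod
      _ = 4 / δ ^ 2 := by field_simp
  have hrest := Finset.sum_le_card_nsmul _ _ _ hfar
  rw [nsmul_eq_mul] at hrest
  have hcard : ((Finset.univ.erase m).card : ℝ) ≤ Fintype.card ι := by
    exact_mod_cast (Finset.card_le_univ _)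
  have hbound : p m / ((d m - x) * (y - d m)) ≤ Fintype.card ι * (4 / δ ^ 2) := by
    rw [← Finset.add_sum_erase _ _ (Finset.mem_univ m)] at hsum
    have hneg : p m / ((x - d m) * (y - d m)) = -(p m / ((d m - x) * (y - d m))) := by
      rw [← div_neg]; ring
    have := mul_le_mul_of_nonneg_right hcard (show 0 ≤ 4 / δ ^ 2 by positivity)
    linarith
  have hab : 0 < (d m - x) * (y - d m) := mul_pos (sub_pos.mpr hxm) (sub_pos.mpr hym)
  have hamgm : (d m - x) * (y - d m) ≤ (y - x) ^ 2 / 4 := by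
    nlinarith [sq_nonneg ((d m - x) - (y - d m))]
  rw [div_le_iff₀ hab] at hbound
  have hle : q ≤ Fintype.card ι * (4 / δ ^ 2) * ((y - x) ^ 2 / 4) :=
    (hqp m).trans (hbound.trans (mul_le_mul_of_nonneg_left hamgm (by positivity)))
  calc q * δ ^ 2 ≤ Fintype.card ι * (4 / δ ^ 2) * ((y - x) ^ 2 / 4) * δ ^ 2 :=
        mul_le_mul_of_nonneg_right hle (by positivity)
    _ = Fintype.card ι * (y - x) ^ 2 := by field_simp

theorem stmt6
    (N : ℕ) (hN : 2 ≤ N)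
    (D : Matrix (Fin N) (Fin N) ℂ) (hD : D.IsHermitian)
    (d : Fin N → ℝ) (hd : StrictMono d)
    (e : Fin N → (Fin N → ℂ))
    (he : ∀ k l, dotc (e k) (e l) = if k = l then 1 else 0)
    (heig : ∀ k, D.mulVec (e k) = (d k : ℂ) • e k)
    (i : Fin N)
    (s : ℝ → ℝ → Fin N → ℝ)
    (hsort : ∀ ε μ : ℝ, Monotone (s ε μ) ∧
      ∃ w : Fin N → (Fin N → ℂ),
        (∀ k l, dotc (w k) (w l) = if k = l then 1 else 0) ∧
        ∀ k, (Hmu D (edgeVec e i ε) μ).mulVec (w k) = ((s ε μ k : ℝ) : ℂ) • w k) :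
    ∀ k : Fin N, ∀ h : (k : ℕ) + 1 < N,
      ∃ C₀ > 0, ∀ ε : ℝ, 0 < ε → ((N : ℝ) - 1) * ε ^ 2 < 1 / 2 →
        ∀ μ : ℝ, 0 < μ →
          s ε μ ⟨(k : ℕ) + 1, h⟩ - s ε μ k > C₀ * ε ^ 2 := by
  intro k h
  obtain ⟨δ, hδ, hsep⟩ := exists_pos_le_abs_sub hd.injective
  have hN' : (2 : ℝ) ≤ N := by exact_mod_cast hN
  have : Nonempty (Fin N) := ⟨i⟩
  refine ⟨δ / (2 * N), by positivity, fun ε hε hε' μ hμ => ?_⟩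
  obtain ⟨hmono, w, hw, hweig⟩ := hsort ε μ
  have hε2 : ε ^ 2 < 1 / 2 := by nlinarith [sq_nonneg ε]
  have hε1 : ε < 1 := by nlinarith
  let a : Fin N → ℝ := fun j => if j = i then 1 - ((N : ℝ) - 1) * ε ^ 2 else ε
  have ha : ∀ j, 0 < a j ∧ ε ^ 2 / 4 ≤ a j ^ 2 ∧ a j ^ 2 ≤ 1 := by
    intro j
    have hnn : 0 ≤ ((N : ℝ) - 1) * ε ^ 2 := mul_nonneg (by linarith) (sq_nonneg ε)
    simp only [a]
    split_ifs
    · refine ⟨by linarith, by nlinarith, by nlinarith⟩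
    · refine ⟨hε, by nlinarith, by nlinarith⟩
  have hlt : k ≤ (⟨(k : ℕ) + 1, h⟩ : Fin N) := Fin.le_def.mpr (Nat.le_succ _)
  have hne : k ≠ (⟨(k : ℕ) + 1, h⟩ : Fin N) := by simp [Fin.ext_iff]
  obtain ⟨hx, hy, hsum⟩ := sum_sq_div_eq_zero hD hd.injective he heig hμ.ne'
    (fun j => dotc_edgeVec he i j ε) (fun j => (ha j).1.ne') (by simp [hw]) (by simp [hw])
    (by rw [hw, if_neg hne]) (hweig k) (hweig ⟨(k : ℕ) + 1, h⟩)
  have hxy := hmono hlt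
  set x := s ε μ k
  set y := s ε μ ⟨(k : ℕ) + 1, h⟩
  have hC : δ / (2 * N) * ε ^ 2 < δ / (2 * N) * ε :=
    mul_lt_mul_of_pos_left (by nlinarith) (by positivity)
  refine hC.trans_le ?_
  rw [div_mul_eq_mul_div, div_le_iff₀ (by positivity)]
  rcases lt_or_ge (y - x) (δ / 2) with hclose | hfar
  · have hgap := mul_sq_le_of_sum_div_eq_zero hδ hsep (by positivity) (fun j => (ha j).2.1)
      (fun j => (ha j).2.2) hxy hx hy hsum hclose
    rw [Fintype.card_fin] at hgap
    refine (sq_le_sq₀ (by positivity)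
      (mul_nonneg (sub_nonneg.mpr hxy) (by positivity))).mp ?_
    nlinarith [mul_nonneg (sq_nonneg (y - x)) (show (0 : ℝ) ≤ N * (N - 1) by nlinarith)]
  · nlinarith [mul_le_mul_of_nonneg_right hfar (show (0 : ℝ) ≤ 2 * N by positivity)]
end

section
/- Purity-based coherent information of the complementary channel (Theorem on PI^c): let Ã, A, B be finite index types, let ã_i, ã_j be two orthonormal vectors in ℂ^Ã, let ψ, φ ∈ ℂ^{A×B} be unit vectors, let α, β ∈ ℂ, and set Ψ := α ã_i ⊗ ψ + β ã_j ⊗ φ ∈ ℂ^{Ã×A×B} with ρ := Ψ Ψ†. Let ρ_{ÃB} be the partial trace of ρ over A and ρ_B the partial trace of ρ over Ã and A. Then Tr(ρ_{ÃB}²) − Tr(ρ_B²) = 2 |α|² |β|² ( Tr[ Tr_A(ψ φ†) · Tr_A(φ ψ†) ] − Tr[ Tr_A(ψ ψ†) · Tr_A(φ φ†) ] ). -/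
open Matrix BigOperators

/-- Partial trace over the second tensor factor:
`(Tr_B M)_{a,a'} = Σ_b M_{(a,b),(a',b)}`. -/
noncomputable def ptraceSnd {A B : Type*} [Fintype B]
    (M : Matrix (A × B) (A × B) ℂ) : Matrix A A ℂ :=
  Matrix.of fun a a' => ∑ b, M (a, b) (a', b)

/-- Partial trace over the first tensor factor:
`(Tr_A M)_{b,b'} = Σ_a M_{(a,b),(a,b')}`. -/
noncomputable def ptraceFst {A B : Type*} [Fintype A]
    (M : Matrix (A × B) (A × B) ℂ) : Matrix B B ℂ :=
  Matrix.of fun b b' => ∑ a, M (a, b) (a, b')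

open scoped Kronecker in
/-- The partial trace over the first factor of a Kronecker product. -/
lemma ptraceFst_kronecker {A B : Type*} [Fintype A] (M : Matrix A A ℂ) (N : Matrix B B ℂ) :
    ptraceFst (M ⊗ₖ N) = M.trace • N := by
  ext b b'
  simp [ptraceFst, Matrix.trace, Finset.sum_mul]

lemma ptraceFst_add {A B : Type*} [Fintype A] (M N : Matrix (A × B) (A × B) ℂ) :
    ptraceFst (M + N) = ptraceFst M + ptraceFst N := by
  ext b b'
  simp [ptraceFst, Finset.sum_add_distrib]

lemma ptraceFst_smul {A B : Type*} [Fintype A] (c : ℂ) (M : Matrix (A × B) (A × B) ℂ) :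
    ptraceFst (c • M) = c • ptraceFst M := by
  ext b b'
  simp [ptraceFst, Finset.mul_sum]

lemma trace_vecMulVec_star {ι : Type*} [Fintype ι] (x y : ι → ℂ) :
    (vecMulVec x (star y)).trace = dotc y x := by
  simp [Matrix.trace, vecMulVec_apply, dotc, mul_comm]

lemma trace_vecMulVec_mul_vecMulVec {ι : Type*} [Fintype ι] (x y z w : ι → ℂ) :
    (vecMulVec x (star y) * vecMulVec z (star w)).trace = dotc y z * dotc w x := by
  rw [vecMulVec_mul_vecMulVec, vecMulVec_smul, trace_smul, trace_vecMulVec_star]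
  simp [dotc, dotProduct]

lemma dotc_eq_zero_symm {ι : Type*} [Fintype ι] {x y : ι → ℂ} (h : dotc x y = 0) :
    dotc y x = 0 := by
  rw [← map_eq_zero (starRingEnd ℂ), ← h]
  simp [dotc, mul_comm]

open scoped Kronecker in
/-- The reduced state of a superposition of two product vectors, as a sum of Kronecker products. -/
lemma ptraceSnd_superposition {At A B : Type*} [Fintype A]
    (x y : At → ℂ) (ψ φ : A × B → ℂ) (α β : ℂ) (Ψ : (At × B) × A → ℂ)
    (hΨ : ∀ p, Ψ p = α * x p.1.1 * ψ (p.2, p.1.2) + β * y p.1.1 * φ (p.2, p.1.2)) :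
    ptraceSnd (vecMulVec Ψ (star Ψ)) =
      (α * star α) • (vecMulVec x (star x) ⊗ₖ ptraceFst (vecMulVec ψ (star ψ))) +
      (α * star β) • (vecMulVec x (star y) ⊗ₖ ptraceFst (vecMulVec ψ (star φ))) +
      (β * star α) • (vecMulVec y (star x) ⊗ₖ ptraceFst (vecMulVec φ (star ψ))) +
      (β * star β) • (vecMulVec y (star y) ⊗ₖ ptraceFst (vecMulVec φ (star φ))) := by
  ext ⟨a, b⟩ ⟨a', b'⟩
  simp only [ptraceSnd, ptraceFst, vecMulVec_apply, of_apply, Matrix.add_apply,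
    Matrix.smul_apply, kroneckerMap_apply, smul_eq_mul, Pi.star_apply, hΨ, star_add, star_mul',
    Finset.mul_sum, ← Finset.sum_add_distrib]
  refine Finset.sum_congr rfl fun c _ => ?_
  ring

theorem stmt15
    {At A B : Type*} [Fintype At] [Fintype A] [Fintype B]
    (ai aj : At → ℂ)
    (hii : dotc ai ai = 1) (hjj : dotc aj aj = 1) (hij : dotc ai aj = 0)
    (ψ φ : A × B → ℂ) (hψ : dotc ψ ψ = 1) (hφ : dotc φ φ = 1)
    (α β : ℂ) :
    let Ψ : (At × B) × A → ℂ :=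
      fun x => α * ai x.1.1 * ψ (x.2, x.1.2) + β * aj x.1.1 * φ (x.2, x.1.2)
    let ρ := Matrix.vecMulVec Ψ (star Ψ)
    let ρAB := ptraceSnd ρ
    let ρB := ptraceFst ρAB
    (ρAB * ρAB).trace - (ρB * ρB).trace =
      ((2 * Complex.normSq α * Complex.normSq β : ℝ) : ℂ) *
        ((ptraceFst (Matrix.vecMulVec ψ (star φ)) *
            ptraceFst (Matrix.vecMulVec φ (star ψ))).trace -
          (ptraceFst (Matrix.vecMulVec ψ (star ψ)) *
            ptraceFst (Matrix.vecMulVec φ (star φ))).trace) := by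
  intro Ψ ρ ρAB ρB
  have hji := dotc_eq_zero_symm hij
  have hAB := ptraceSnd_superposition ai aj ψ φ α β Ψ fun _ => rfl
  have hα : (Complex.normSq α : ℂ) = α * star α := (Complex.mul_conj α).symm
  have hβ : (Complex.normSq β : ℂ) = β * star β := (Complex.mul_conj β).symm
  simp only [ρB, ρAB, ρ, hAB, ptraceFst_add, ptraceFst_smul, ptraceFst_kronecker,
    trace_vecMulVec_star, hii, hjj, hij, hji, add_mul, mul_add, smul_mul_assoc, mul_smul_comm,
    ← mul_kronecker_mul, trace_add, trace_smul, trace_kronecker,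
    trace_vecMulVec_mul_vecMulVec, smul_eq_mul, zero_smul, smul_zero, one_smul, add_zero,
    zero_add, zero_mul, mul_zero, one_mul, mul_one]
  push_cast
  rw [hα, hβ,
    trace_mul_comm (ptraceFst (vecMulVec φ (star φ))) (ptraceFst (vecMulVec ψ (star ψ))),
    trace_mul_comm (ptraceFst (vecMulVec φ (star ψ))) (ptraceFst (vecMulVec ψ (star φ)))]
  ring
end

section
/- Purity formula for resolvent eigenstates: let s ∈ ℝ with s ≠ d_{ij} for all i, j, let v ∈ ℂ^n ⊗ ℂ^m, set γ := 1/‖(sI − D)^{-1} v‖ and |s⟩ := γ (sI − D)^{-1} v, and let ρ_A := Tr_B(|s⟩⟨s|). Then the purity of ρ_A equals Tr(ρ_A²) = γ⁴ Σ_{i,k<n} Σ_{j,p<m} [ v_{ij}/(s − d_{ij}) ] · [ \overline{v_{kj}}/(s − d_{kj}) ] · [ v_{kp}/(s − d_{kp}) ] · [ \overline{v_{ip}}/(s − d_{ip}) ], where γ = ( Σ_{i,j} |v_{ij}|²/(s − d_{ij})² )^{-1/2}. -/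
open Matrix BigOperators

/-- The Kronecker sum `H_A ⊗ I + I ⊗ H_B`. -/
noncomputable def kronSum {n m : ℕ} (HA : Matrix (Fin n) (Fin n) ℂ)
    (HB : Matrix (Fin m) (Fin m) ℂ) : Matrix (Fin n × Fin m) (Fin n × Fin m) ℂ :=
  Matrix.kroneckerMap (· * ·) HA (1 : Matrix (Fin m) (Fin m) ℂ) +
    Matrix.kroneckerMap (· * ·) (1 : Matrix (Fin n) (Fin n) ℂ) HB

/-- The matrix whose columns are the vectors `a k`. -/
def columnMatrix {ι κ : Type*} (a : κ → ι → ℂ) : Matrix ι κ ℂ :=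
  Matrix.of fun x k => a k x

lemma columnMatrix_conjTranspose_mul_self {ι : Type*} [Fintype ι] [DecidableEq ι]
    {a : ι → ι → ℂ} (ha : ∀ k l, dotc (a k) (a l) = if k = l then 1 else 0) :
    (columnMatrix a)ᴴ * columnMatrix a = 1 := by
  ext k l
  simpa [columnMatrix, Matrix.mul_apply, Matrix.one_apply, dotc] using ha k l

/-- The matrix of coefficients of a bipartite vector in a product basis. -/
lemma of_dotc_product {ι κ : Type*} [Fintype ι] [Fintype κ]
    (a : ι → ι → ℂ) (b : κ → κ → ℂ) (v : ι × κ → ℂ) :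
    (Matrix.of fun k p => dotc (fun q : ι × κ => a k q.1 * b p q.2) v) =
      (columnMatrix a)ᴴ * Matrix.of (fun x y => v (x, y)) * (columnMatrix b)ᵀᴴ := by
  ext k p
  simp only [Matrix.of_apply, dotc, Fintype.sum_prod_type, Matrix.mul_apply, Finset.sum_mul]
  rw [Finset.sum_comm]
  refine Finset.sum_congr rfl fun y _ => Finset.sum_congr rfl fun x _ => ?_
  simp [columnMatrix]
  ring

lemma columnMatrix_mul_mul_transpose_apply {ι κ : Type*} [Fintype ι] [Fintype κ]
    (a : ι → ι → ℂ) (b : κ → κ → ℂ) (C : Matrix ι κ ℂ) (x : ι) (y : κ) :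
    (columnMatrix a * C * (columnMatrix b)ᵀ) x y =
      (∑ q : ι × κ, C q.1 q.2 • fun r : ι × κ => a q.1 r.1 * b q.2 r.2) (x, y) := by
  simp only [Matrix.mul_apply, Finset.sum_mul, Finset.sum_apply, Fintype.sum_prod_type]
  rw [Finset.sum_comm]
  refine Finset.sum_congr rfl fun k _ => Finset.sum_congr rfl fun p _ => ?_
  simp [columnMatrix]
  ring

lemma transpose_mul_conjTranspose_transpose {κ : Type*} [Fintype κ] [DecidableEq κ]
    {B : Matrix κ κ ℂ} (hB : Bᴴ * B = 1) : Bᵀ * Bᵀᴴ = 1 := by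
  rw [show Bᵀᴴ = Bᴴᵀ from rfl, ← Matrix.transpose_mul, hB, Matrix.transpose_one]

/-- A bipartite vector is the sum of its components along an orthonormal product basis. -/
lemma sum_dotc_smul_product {ι κ : Type*} [Fintype ι] [Fintype κ] [DecidableEq ι] [DecidableEq κ]
    {a : ι → ι → ℂ} (ha : ∀ k l, dotc (a k) (a l) = if k = l then 1 else 0)
    {b : κ → κ → ℂ} (hb : ∀ k l, dotc (b k) (b l) = if k = l then 1 else 0)
    (v : ι × κ → ℂ) :
    ∑ q : ι × κ, dotc (fun r : ι × κ => a q.1 r.1 * b q.2 r.2) v •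
      (fun r : ι × κ => a q.1 r.1 * b q.2 r.2) = v := by
  ext ⟨x, y⟩
  have hA := mul_eq_one_comm.mp (columnMatrix_conjTranspose_mul_self ha)
  have hB := mul_eq_one_comm.mp
    (transpose_mul_conjTranspose_transpose (columnMatrix_conjTranspose_mul_self hb))
  have key := columnMatrix_mul_mul_transpose_apply a b
    (Matrix.of fun k p => dotc (fun q : ι × κ => a k q.1 * b p q.2) v) x y
  refine key.symm.trans ?_
  have : columnMatrix a * ((columnMatrix a)ᴴ * Matrix.of (fun x y => v (x, y)) *
      (columnMatrix b)ᵀᴴ) * (columnMatrix b)ᵀ = Matrix.of (fun x y => v (x, y)) := by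
    rw [← Matrix.mul_assoc, ← Matrix.mul_assoc, hA, Matrix.one_mul, Matrix.mul_assoc, hB,
      Matrix.mul_one]
  rw [of_dotc_product, this, Matrix.of_apply]

/-- The inverse of `s - D` divides the components along a spanning family of eigenvectors
by `s - d`. -/
lemma resolvent_mulVec_eq_sum {ι κ : Type*} [Fintype ι] [DecidableEq ι] [Fintype κ]
    (D : Matrix ι ι ℂ) (e : κ → ι → ℂ) (d : κ → ℂ) (heig : ∀ q, D.mulVec (e q) = d q • e q)
    (c : (ι → ℂ) → κ → ℂ) (hc : ∀ v, ∑ q, c v q • e q = v) (s : ℂ) (hs : ∀ q, s - d q ≠ 0)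
    (v : ι → ℂ) :
    ((s • (1 : Matrix ι ι ℂ) - D)⁻¹).mulVec v = ∑ q, (c v q / (s - d q)) • e q := by
  have hw : ∀ v, (s • (1 : Matrix ι ι ℂ) - D).mulVec (∑ q, (c v q / (s - d q)) • e q) = v := by
    intro v
    conv_rhs => rw [← hc v]
    rw [Matrix.mulVec_sum]
    refine Finset.sum_congr rfl fun q _ => ?_
    rw [Matrix.mulVec_smul, Matrix.sub_mulVec, Matrix.smul_mulVec, Matrix.one_mulVec, heig,
      ← sub_smul, smul_smul, div_mul_cancel₀ _ (hs q)]
  have hunit : IsUnit (s • (1 : Matrix ι ι ℂ) - D) :=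
    Matrix.mulVec_surjective_iff_isUnit.mp fun v => ⟨_, hw v⟩
  conv_lhs => rw [← hw v]
  rw [Matrix.mulVec_mulVec, Matrix.nonsing_inv_mul _ ((Matrix.isUnit_iff_isUnit_det _).mp hunit),
    Matrix.one_mulVec]

lemma ptraceSnd_vecMulVec_star {ι κ : Type*} [Fintype κ] (w : ι × κ → ℂ) :
    ptraceSnd (Matrix.vecMulVec w (star w)) =
      Matrix.of (fun x y => w (x, y)) * (Matrix.of fun x y => w (x, y))ᴴ := by
  ext x x'
  simp [ptraceSnd, Matrix.vecMulVec_apply, Matrix.mul_apply]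

lemma local_unitary_mul_conjTranspose {ι κ : Type*} [Fintype ι] [Fintype κ] [DecidableEq κ]
    (A : Matrix ι ι ℂ) {B : Matrix κ κ ℂ} (hB : Bᴴ * B = 1) (C : Matrix ι κ ℂ) :
    (A * C * Bᵀ) * (A * C * Bᵀ)ᴴ = A * (C * Cᴴ) * Aᴴ := by
  rw [Matrix.conjTranspose_mul, Matrix.conjTranspose_mul]
  calc A * C * Bᵀ * (Bᵀᴴ * (Cᴴ * Aᴴ)) = A * C * (Bᵀ * Bᵀᴴ) * (Cᴴ * Aᴴ) := by
        simp only [Matrix.mul_assoc]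
    _ = A * (C * Cᴴ) * Aᴴ := by
        rw [transpose_mul_conjTranspose_transpose hB, Matrix.mul_one]
        simp only [Matrix.mul_assoc]

lemma trace_unitary_conj {ι : Type*} [Fintype ι] [DecidableEq ι] {A : Matrix ι ι ℂ}
    (hA : Aᴴ * A = 1) (M : Matrix ι ι ℂ) : (A * M * Aᴴ).trace = M.trace := by
  rw [Matrix.trace_mul_comm, ← Matrix.mul_assoc, hA, Matrix.one_mul]

lemma trace_mul_conjTranspose_sq {ι κ : Type*} [Fintype ι] [Fintype κ] (C : Matrix ι κ ℂ) :
    (C * Cᴴ * (C * Cᴴ)).trace =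
      ∑ i, ∑ k, ∑ j, ∑ p, C i j * star (C k j) * C k p * star (C i p) := by
  simp only [Matrix.trace, Matrix.diag_apply, Matrix.mul_apply, Finset.sum_mul_sum,
    Matrix.conjTranspose_apply, mul_assoc]

lemma sum_normSq_eq_trace {ι κ : Type*} [Fintype ι] [Fintype κ] (C : Matrix ι κ ℂ) :
    ((∑ i, ∑ j, Complex.normSq (C i j) : ℝ) : ℂ) = (C * Cᴴ).trace := by
  simp [Matrix.trace, Matrix.mul_apply, Complex.mul_conj]

theorem stmt16
    (n m : ℕ) (hn : 2 ≤ n) (hm : 2 ≤ m)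
    (HA : Matrix (Fin n) (Fin n) ℂ) (hHA : HA.IsHermitian)
    (HB : Matrix (Fin m) (Fin m) ℂ) (hHB : HB.IsHermitian)
    (a : Fin n → (Fin n → ℂ)) (ha : ∀ k l, dotc (a k) (a l) = if k = l then 1 else 0)
    (b : Fin m → (Fin m → ℂ)) (hb : ∀ k l, dotc (b k) (b l) = if k = l then 1 else 0)
    (d : Fin n → Fin m → ℝ)
    (heig : ∀ k p, (kronSum HA HB).mulVec (fun q => a k q.1 * b p q.2) =
      (d k p : ℂ) • fun q => a k q.1 * b p q.2)
    (hdist : Function.Injective fun q : Fin n × Fin m => d q.1 q.2)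
    (s : ℝ) (hs : ∀ k p, s ≠ d k p)
    (v : Fin n × Fin m → ℂ) :
    let u : Fin n × Fin m → ℂ :=
      (((s : ℂ) • (1 : Matrix (Fin n × Fin m) (Fin n × Fin m) ℂ) - kronSum HA HB)⁻¹).mulVec v
    let γ : ℝ := (cnorm u)⁻¹
    let ket : Fin n × Fin m → ℂ := ((γ : ℝ) : ℂ) • u
    let ρA := ptraceSnd (Matrix.vecMulVec ket (star ket))
    let vc : Fin n → Fin m → ℂ := fun k p => dotc (fun q => a k q.1 * b p q.2) v
    (ρA * ρA).trace =
        ((γ : ℝ) : ℂ) ^ 4 *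
          ∑ i : Fin n, ∑ k : Fin n, ∑ j : Fin m, ∑ p : Fin m,
            (vc i j / ((s : ℂ) - (d i j : ℂ))) *
            ((starRingEnd ℂ) (vc k j) / ((s : ℂ) - (d k j : ℂ))) *
            (vc k p / ((s : ℂ) - (d k p : ℂ))) *
            ((starRingEnd ℂ) (vc i p) / ((s : ℂ) - (d i p : ℂ))) ∧
      γ = (Real.sqrt (∑ i : Fin n, ∑ j : Fin m,
            Complex.normSq (vc i j) / (s - d i j) ^ 2))⁻¹ := by
  intro u γ ket ρA vc
  have hA := columnMatrix_conjTranspose_mul_self ha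
  have hB := columnMatrix_conjTranspose_mul_self hb
  set C : Matrix (Fin n) (Fin m) ℂ := Matrix.of fun k p => vc k p / ((s : ℂ) - (d k p : ℂ))
    with hC
  have hres : u = ∑ q : Fin n × Fin m, C q.1 q.2 • fun r : Fin n × Fin m =>
      a q.1 r.1 * b q.2 r.2 :=
    resolvent_mulVec_eq_sum (kronSum HA HB)
      (fun q : Fin n × Fin m => fun r : Fin n × Fin m => a q.1 r.1 * b q.2 r.2)
      (fun q => (d q.1 q.2 : ℂ)) (fun q => heig q.1 q.2)
      (fun v q => dotc (fun r : Fin n × Fin m => a q.1 r.1 * b q.2 r.2) v)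
      (sum_dotc_smul_product ha hb) (s : ℂ)
      (fun q => sub_ne_zero.mpr (Complex.ofReal_injective.ne (hs q.1 q.2))) v
  have hu : Matrix.of (fun x y => u (x, y)) = columnMatrix a * C * (columnMatrix b)ᵀ := by
    ext x y
    rw [columnMatrix_mul_mul_transpose_apply, Matrix.of_apply, hres]
  have huu := local_unitary_mul_conjTranspose (columnMatrix a) hB C
  rw [← hu] at huu
  constructor
  · have hket : Matrix.of (fun x y => ket (x, y)) = (γ : ℂ) • Matrix.of (fun x y => u (x, y)) := rfl
    have hρ : ρA = (γ : ℂ) ^ 2 • (columnMatrix a * (C * Cᴴ) * (columnMatrix a)ᴴ) := by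
      rw [← huu]
      refine (ptraceSnd_vecMulVec_star ket).trans ?_
      rw [hket, Matrix.conjTranspose_smul, Matrix.smul_mul, Matrix.mul_smul, smul_smul]
      simp [sq]
    have hsq : columnMatrix a * (C * Cᴴ) * (columnMatrix a)ᴴ *
        (columnMatrix a * (C * Cᴴ) * (columnMatrix a)ᴴ) =
        columnMatrix a * (C * Cᴴ * (C * Cᴴ)) * (columnMatrix a)ᴴ := by
      calc _ = columnMatrix a * (C * Cᴴ) * ((columnMatrix a)ᴴ * columnMatrix a) * (C * Cᴴ) *
            (columnMatrix a)ᴴ := by simp only [Matrix.mul_assoc]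
        _ = _ := by rw [hA, Matrix.mul_one]; simp only [Matrix.mul_assoc]
    rw [hρ, Matrix.smul_mul, Matrix.mul_smul, smul_smul, hsq, Matrix.trace_smul,
      trace_unitary_conj hA, trace_mul_conjTranspose_sq, smul_eq_mul, ← pow_add]
    simp [hC]
  · have hnorm : ∑ q, Complex.normSq (u q) = ∑ i, ∑ j, Complex.normSq (C i j) := by
      rw [Fintype.sum_prod_type]
      apply Complex.ofReal_injective
      have h := sum_normSq_eq_trace (Matrix.of fun x y => u (x, y))
      rw [huu, trace_unitary_conj hA, ← sum_normSq_eq_trace] at h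
      exact h
    change (Real.sqrt (∑ q, Complex.normSq (u q)))⁻¹ = _
    rw [hnorm]
    congr 2
    refine Finset.sum_congr rfl fun i _ => Finset.sum_congr rfl fun j _ => ?_
    rw [hC, Matrix.of_apply, Complex.normSq_div, ← Complex.ofReal_sub, Complex.normSq_ofReal, sq]
end

section
/- Generalized purity formula: let s, s', s'', s''' ∈ ℝ, each distinct from every d_{ij}, let v ∈ ℂ^n ⊗ ℂ^m, and for each value t ∈ {s, s', s'', s'''} set γ_t := 1/‖(tI − D)^{-1} v‖ and |t⟩ := γ_t (tI − D)^{-1} v. Then Tr[ Tr_B(|s⟩⟨s'|) · Tr_B(|s''⟩⟨s'''|) ] = γ_s γ_{s'} γ_{s''} γ_{s'''} Σ_{i,k<n} Σ_{j,p<m} [ v_{ij}/(s − d_{ij}) ] · [ \overline{v_{kj}}/(s' − d_{kj}) ] · [ v_{kp}/(s'' − d_{kp}) ] · [ \overline{v_{ip}}/(s''' − d_{ip}) ]. -/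
open Matrix BigOperators

/-- Orthonormal columns make the adjoint a left inverse. -/
theorem conjTranspose_mul_self_of_dotc {ι κ : Type*} [Fintype ι] [DecidableEq κ]
    (a : κ → ι → ℂ) (ha : ∀ k l, dotc (a k) (a l) = if k = l then 1 else 0) :
    (Matrix.of fun x k => a k x)ᴴ * (Matrix.of fun x k => a k x) = 1 := by
  ext k l
  simpa [Matrix.mul_apply, Matrix.one_apply, dotc] using ha k l

/-- The inner product of product vectors factors. -/
theorem dotc_prod {ι κ : Type*} [Fintype ι] [Fintype κ] (x x' : ι → ℂ) (y y' : κ → ℂ) :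
    dotc (fun q : ι × κ => x q.1 * y q.2) (fun q => x' q.1 * y' q.2) =
      dotc x x' * dotc y y' := by
  simp only [dotc, Fintype.sum_prod_type, Finset.sum_mul_sum, map_mul]
  exact Finset.sum_congr rfl fun i _ => Finset.sum_congr rfl fun j _ => by ring

/-- Spectral expansion of the resolvent in an orthonormal eigenbasis. -/
theorem resolvent_mulVec_apply {ι : Type*} [Fintype ι] [DecidableEq ι] (D : Matrix ι ι ℂ)
    (e : ι → ι → ℂ) (he : ∀ k l, dotc (e k) (e l) = if k = l then 1 else 0) (d : ι → ℂ)
    (hD : ∀ k, D.mulVec (e k) = d k • e k) (t : ℂ) (ht : ∀ k, t ≠ d k) (v : ι → ℂ) (q : ι) :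
    (t • (1 : Matrix ι ι ℂ) - D)⁻¹.mulVec v q = ∑ k, e k q * (dotc (e k) v / (t - d k)) := by
  set W : Matrix ι ι ℂ := Matrix.of fun x k => e k x with hW
  have hWW : Wᴴ * W = 1 := conjTranspose_mul_self_of_dotc e he
  have hWW' : W * Wᴴ = 1 := mul_eq_one_comm.mp hWW
  have hDW : D * W = W * Matrix.diagonal d := by
    ext x k
    simpa [Matrix.mul_apply, Matrix.mulVec, dotProduct, hW, mul_comm, Matrix.diagonal_apply] using
      congrFun (hD k) x
  have hMW : (t • (1 : Matrix ι ι ℂ) - D) * W = W * Matrix.diagonal (fun k => t - d k) := by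
    rw [sub_mul, hDW]
    ext x k
    simp [Matrix.mul_diagonal]
    ring
  have hinv : (t • (1 : Matrix ι ι ℂ) - D)⁻¹ =
      W * (Matrix.diagonal (fun k => (t - d k)⁻¹) * Wᴴ) := by
    apply Matrix.inv_eq_right_inv
    have hdd : Matrix.diagonal (fun k => t - d k) * Matrix.diagonal (fun k => (t - d k)⁻¹) = 1 := by
      rw [Matrix.diagonal_mul_diagonal, ← Matrix.diagonal_one]
      congr 1
      funext k
      exact mul_inv_cancel₀ (sub_ne_zero.mpr (ht k))
    rw [← mul_assoc, hMW, mul_assoc, ← mul_assoc (Matrix.diagonal _), hdd, one_mul, hWW']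
  rw [hinv, ← Matrix.mulVec_mulVec, ← Matrix.mulVec_mulVec]
  simp only [Matrix.mulVec, dotProduct, Matrix.diagonal_apply, ite_mul, zero_mul,
    Finset.sum_ite_eq, Finset.mem_univ, if_true]
  refine Finset.sum_congr rfl fun k _ => ?_
  simp only [hW, Matrix.of_apply, Matrix.conjTranspose_apply, dotc, starRingEnd_apply]
  ring

/-- The partial trace of an outer product, in terms of the coefficient matrices. -/
theorem ptraceSnd_vecMulVec_smul {A B : Type*} [Fintype B] (r r' : ℝ) (x y : A × B → ℂ) :
    ptraceSnd (Matrix.vecMulVec ((r : ℂ) • x) (star ((r' : ℂ) • y))) =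
      ((r * r' : ℝ) : ℂ) •
        ((Matrix.of fun i j => x (i, j)) * (Matrix.of fun i j => y (i, j))ᴴ) := by
  ext i k
  simp only [ptraceSnd, Matrix.vecMulVec_apply, Matrix.of_apply, Matrix.smul_apply,
    Matrix.mul_apply, Matrix.conjTranspose_apply, Pi.smul_apply, Pi.star_apply, smul_eq_mul,
    Finset.mul_sum, star_mul', Complex.star_def, Complex.conj_ofReal, Complex.ofReal_mul]
  exact Finset.sum_congr rfl fun j _ => by ring

/-- The fourfold trace is invariant under local isometries. -/
theorem trace_mul_conjTranspose_isometry {ι κ : Type*} [Fintype ι] [Fintype κ] [DecidableEq ι]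
    [DecidableEq κ] (U : Matrix ι ι ℂ) (V : Matrix κ κ ℂ) (hU : Uᴴ * U = 1) (hV : V * Vᴴ = 1)
    (C₁ C₂ C₃ C₄ : Matrix ι κ ℂ) :
    (((U * C₁ * V) * (U * C₂ * V)ᴴ) * ((U * C₃ * V) * (U * C₄ * V)ᴴ)).trace =
      ((C₁ * C₂ᴴ) * (C₃ * C₄ᴴ)).trace := by
  have h (X Y : Matrix ι κ ℂ) : (U * X * V) * (U * Y * V)ᴴ = U * (X * Yᴴ) * Uᴴ := by
    calc (U * X * V) * (U * Y * V)ᴴ = U * X * (V * Vᴴ) * Yᴴ * Uᴴ := by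
          simp only [Matrix.conjTranspose_mul, Matrix.mul_assoc]
      _ = U * (X * Yᴴ) * Uᴴ := by rw [hV, Matrix.mul_one, Matrix.mul_assoc U]
  rw [h, h]
  calc (U * (C₁ * C₂ᴴ) * Uᴴ * (U * (C₃ * C₄ᴴ) * Uᴴ)).trace
      = (U * (C₁ * C₂ᴴ) * (Uᴴ * U) * (C₃ * C₄ᴴ) * Uᴴ).trace := by
        simp only [Matrix.mul_assoc]
    _ = (Uᴴ * (U * (C₁ * C₂ᴴ) * (C₃ * C₄ᴴ))).trace := by
        rw [hU, Matrix.mul_one, Matrix.trace_mul_comm]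
    _ = ((Uᴴ * U) * ((C₁ * C₂ᴴ) * (C₃ * C₄ᴴ))).trace := by
        simp only [Matrix.mul_assoc]
    _ = _ := by rw [hU, Matrix.one_mul]

theorem stmt17
    (n m : ℕ) (hn : 2 ≤ n) (hm : 2 ≤ m)
    (HA : Matrix (Fin n) (Fin n) ℂ) (hHA : HA.IsHermitian)
    (HB : Matrix (Fin m) (Fin m) ℂ) (hHB : HB.IsHermitian)
    (a : Fin n → (Fin n → ℂ)) (ha : ∀ k l, dotc (a k) (a l) = if k = l then 1 else 0)
    (b : Fin m → (Fin m → ℂ)) (hb : ∀ k l, dotc (b k) (b l) = if k = l then 1 else 0)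
    (d : Fin n → Fin m → ℝ)
    (heig : ∀ k p, (kronSum HA HB).mulVec (fun q => a k q.1 * b p q.2) =
      (d k p : ℂ) • fun q => a k q.1 * b p q.2)
    (hdist : Function.Injective fun q : Fin n × Fin m => d q.1 q.2)
    (s₁ s₂ s₃ s₄ : ℝ)
    (hs₁ : ∀ k p, s₁ ≠ d k p) (hs₂ : ∀ k p, s₂ ≠ d k p)
    (hs₃ : ∀ k p, s₃ ≠ d k p) (hs₄ : ∀ k p, s₄ ≠ d k p)
    (v : Fin n × Fin m → ℂ) :
    let res : ℝ → (Fin n × Fin m → ℂ) := fun t =>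
      (((t : ℂ) • (1 : Matrix (Fin n × Fin m) (Fin n × Fin m) ℂ) - kronSum HA HB)⁻¹).mulVec v
    let γ : ℝ → ℝ := fun t => (cnorm (res t))⁻¹
    let ket : ℝ → (Fin n × Fin m → ℂ) := fun t => ((γ t : ℝ) : ℂ) • res t
    let vc : Fin n → Fin m → ℂ := fun k p => dotc (fun q => a k q.1 * b p q.2) v
    (ptraceSnd (Matrix.vecMulVec (ket s₁) (star (ket s₂))) *
        ptraceSnd (Matrix.vecMulVec (ket s₃) (star (ket s₄)))).trace =
      ((γ s₁ * γ s₂ * γ s₃ * γ s₄ : ℝ) : ℂ) *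
        ∑ i : Fin n, ∑ k : Fin n, ∑ j : Fin m, ∑ p : Fin m,
          (vc i j / ((s₁ : ℂ) - (d i j : ℂ))) *
          ((starRingEnd ℂ) (vc k j) / ((s₂ : ℂ) - (d k j : ℂ))) *
          (vc k p / ((s₃ : ℂ) - (d k p : ℂ))) *
          ((starRingEnd ℂ) (vc i p) / ((s₄ : ℂ) - (d i p : ℂ))) := by
  intro res γ ket vc
  set U : Matrix (Fin n) (Fin n) ℂ := Matrix.of fun x k => a k x with hU
  set V : Matrix (Fin m) (Fin m) ℂ := Matrix.of fun x k => b k x with hV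
  let C : ℝ → Matrix (Fin n) (Fin m) ℂ := fun t =>
    Matrix.of fun i j => vc i j / ((t : ℂ) - (d i j : ℂ))
  have hUU : Uᴴ * U = 1 := conjTranspose_mul_self_of_dotc a ha
  have hVV : Vᵀ * Vᵀᴴ = 1 := by
    have h : Vᴴ * V = 1 := conjTranspose_mul_self_of_dotc b hb
    have h' := congrArg Matrix.transpose h
    rwa [Matrix.transpose_mul, Matrix.transpose_one] at h'
  have hres (t : ℝ) (ht : ∀ k p, t ≠ d k p) :
      (Matrix.of fun i j => res t (i, j)) = U * C t * Vᵀ := by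
    ext x y
    have h := resolvent_mulVec_apply (kronSum HA HB)
      (fun k : Fin n × Fin m => fun q => a k.1 q.1 * b k.2 q.2)
      (fun k l => by
        rw [dotc_prod, ha, hb]
        simp only [Prod.ext_iff]
        split_ifs <;> simp_all)
      (fun k => (d k.1 k.2 : ℂ)) (fun k => heig k.1 k.2) t
      (fun k => by exact_mod_cast ht k.1 k.2) v (x, y)
    rw [Matrix.of_apply]
    refine h.trans ?_
    rw [Fintype.sum_prod_type_right, Matrix.mul_apply]
    refine Finset.sum_congr rfl fun j _ => ?_
    rw [Matrix.mul_apply, Finset.sum_mul]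
    refine Finset.sum_congr rfl fun i _ => ?_
    simp only [hU, hV, C, vc, Matrix.of_apply, Matrix.transpose_apply]
    ring
  simp only [ket]
  rw [ptraceSnd_vecMulVec_smul, ptraceSnd_vecMulVec_smul, hres s₁ hs₁, hres s₂ hs₂, hres s₃ hs₃,
    hres s₄ hs₄, Matrix.smul_mul, Matrix.mul_smul, smul_smul, Matrix.trace_smul,
    trace_mul_conjTranspose_isometry U Vᵀ hUU hVV, smul_eq_mul, ← Complex.ofReal_mul,
    ← mul_assoc (γ s₁ * γ s₂)]
  congr 1
  simp only [Matrix.trace, Matrix.diag_apply, Matrix.mul_apply, Finset.sum_mul_sum]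
  refine Finset.sum_congr rfl fun i _ => Finset.sum_congr rfl fun k _ =>
    Finset.sum_congr rfl fun j _ => Finset.sum_congr rfl fun p _ => ?_
  simp only [C, Matrix.of_apply, Matrix.conjTranspose_apply, Complex.star_def, map_div₀, map_sub,
    Complex.conj_ofReal]
  ring
end
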